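/- Let A > −1 and T ≥ 0 be real numbers. Then (1/(2π))·∫_0^∞ [Γ(is)·Γ(−is)·Γ(1/2+is)·Γ(1/2−is)·Γ(1/2+T+is)·Γ(1/2+T−is)/(Γ(2is)·Γ(−2is))]·φ_A(s) ds = Γ(1/2)·Γ(1+T)·Γ(1/2+T)·(1+A)^{−1/2−T}. -/

import Mathlib

open MeasureTheory

/-- Closed form of the hypergeometric value `F(is,−is;1/2;−A)` for `A > −1`:
`cos(2s·log(√(A+1)+√A))` when `A ≥ 0`, and `cosh(2s·arcsin√(−A))` when `−1 < A < 0`. -/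
noncomputable def phiF (A s : ℝ) : ℝ :=
  if 0 ≤ A then Real.cos (2 * s * Real.log (Real.sqrt (A + 1) + Real.sqrt A))
  else Real.cosh (2 * s * Real.arcsin (Real.sqrt (-A)))


lemma aux_norm {s r : ℂ} {t : ℝ} (ht : 0 < t) :
    ‖(t : ℂ) ^ (s - 1) * Complex.exp (-(r * t))‖ = t ^ (s.re - 1) * Real.exp (-(r.re * t)) := by
  rw [norm_mul, Complex.norm_cpow_eq_rpow_re_of_pos ht, Complex.norm_exp]
  simp

lemma aux_real_int {σ c : ℝ} (hσ : 0 < σ) (hc : 0 < c) :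
    IntegrableOn (fun t : ℝ => t ^ (σ - 1) * Real.exp (-(c * t))) (Set.Ioi 0) := by
  have := integrableOn_rpow_mul_exp_neg_mul_rpow (p := 1) (s := σ - 1) (b := c)
    (by linarith) one_pos hc
  simpa using this

lemma aux_meas (s r : ℂ) : AEStronglyMeasurable
    (fun t : ℝ => (t : ℂ) ^ (s - 1) * Complex.exp (-(r * t))) (volume.restrict (Set.Ioi 0)) := by
  refine ContinuousOn.aestronglyMeasurable ?_ measurableSet_Ioi
  refine ContinuousOn.mul ?_ (by fun_prop)
  intro t ht
  refine ContinuousAt.continuousWithinAt ?_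
  exact (Complex.continuousAt_ofReal_cpow_const t (s - 1) (Or.inr (ne_of_gt ht)))

lemma aux_int {s r : ℂ} (hs : 0 < s.re) (hr : 0 < r.re) :
    IntegrableOn (fun t : ℝ => (t : ℂ) ^ (s - 1) * Complex.exp (-(r * t))) (Set.Ioi 0) := by
  refine Integrable.mono' (aux_real_int hs hr) (aux_meas s r) ?_
  refine (ae_restrict_iff' measurableSet_Ioi).2 (Filter.Eventually.of_forall fun t ht => ?_)
  exact (aux_norm ht).le

lemma aux_deriv {s r : ℂ} (hs : 0 < s.re) (hr : 0 < r.re) :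
    DifferentiableAt ℂ (fun r : ℂ => ∫ t : ℝ in Set.Ioi 0,
      (t : ℂ) ^ (s - 1) * Complex.exp (-(r * t))) r := by
  have hmem : {x : ℂ | r.re / 2 < x.re} ∈ nhds r :=
    (isOpen_lt continuous_const Complex.continuous_re).mem_nhds
      (by show r.re / 2 < r.re; linarith)
  have := hasDerivAt_integral_of_dominated_loc_of_deriv_le (𝕜 := ℂ)
    (μ := volume.restrict (Set.Ioi (0 : ℝ)))
    (F := fun (r : ℂ) (t : ℝ) => (t : ℂ) ^ (s - 1) * Complex.exp (-(r * t)))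
    (F' := fun (r : ℂ) (t : ℝ) => (t : ℂ) ^ (s - 1) * Complex.exp (-(r * t)) * (-t))
    (x₀ := r) (s := {x : ℂ | r.re / 2 < x.re})
    (bound := fun t : ℝ => t ^ ((s.re + 1) - 1) * Real.exp (-(r.re / 2 * t)))
    hmem (Filter.Eventually.of_forall fun x => aux_meas s x) (aux_int hs hr)
    ((aux_meas s r).mul (Continuous.aestronglyMeasurable (by fun_prop)))
    ?_ (aux_real_int (by linarith) (by linarith)) ?_
  · exact this.2.differentiableAt
  · refine (ae_restrict_iff' measurableSet_Ioi).2 (Filter.Eventually.of_forall fun t ht x hx => ?_)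
    have ht' : (0 : ℝ) < t := ht
    have hx' : r.re / 2 < x.re := hx
    rw [norm_mul, aux_norm ht, norm_neg, Complex.norm_real, Real.norm_of_nonneg ht'.le,
      show s.re + 1 - 1 = (s.re - 1) + 1 by ring, Real.rpow_add ht', Real.rpow_one,
      mul_right_comm]
    gcongr
  · refine Filter.Eventually.of_forall fun t x hx => ?_
    have h1 : HasDerivAt (fun x : ℂ => -(x * (t : ℂ))) (-(t : ℂ)) x := by
      simpa using! ((hasDerivAt_id x).mul_const (t : ℂ)).fun_neg
    have := (h1.cexp).const_mul ((t : ℂ) ^ (s - 1))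
    simpa [mul_assoc] using this

lemma aux_formula {s r : ℂ} (hs : 0 < s.re) (hr : 0 < r.re) :
    ∫ t : ℝ in Set.Ioi 0, (t : ℂ) ^ (s - 1) * Complex.exp (-(r * t)) =
      r ^ (-s) * Complex.Gamma s := by
  have hopen : IsOpen {x : ℂ | 0 < x.re} := isOpen_lt continuous_const Complex.continuous_re
  have hpre : IsPreconnected {x : ℂ | 0 < x.re} :=
    (convex_halfSpace_re_gt 0).isPreconnected
  have hF : AnalyticOnNhd ℂ (fun r : ℂ => ∫ t : ℝ in Set.Ioi 0,
      (t : ℂ) ^ (s - 1) * Complex.exp (-(r * t))) {x : ℂ | 0 < x.re} :=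
    DifferentiableOn.analyticOnNhd
      (fun x hx => (aux_deriv hs hx).differentiableWithinAt) hopen
  have hG : AnalyticOnNhd ℂ (fun r : ℂ => r ^ (-s) * Complex.Gamma s) {x : ℂ | 0 < x.re} := by
    refine DifferentiableOn.analyticOnNhd (fun x hx => ?_) hopen
    refine DifferentiableAt.differentiableWithinAt ?_
    refine DifferentiableAt.mul_const ?_ _
    exact DifferentiableAt.cpow_const differentiableAt_id (Or.inl hx)
  refine hF.eqOn_of_preconnected_of_frequently_eq hG hpre (z₀ := 1) (by simp) ?_ hr
  have hlim : Filter.Tendsto (fun n : ℕ => (1 : ℂ) + ((1 / ((n : ℝ) + 1) : ℝ) : ℂ))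
      Filter.atTop (nhdsWithin 1 {1}ᶜ) := by
    refine tendsto_nhdsWithin_iff.2 ⟨?_, Filter.Eventually.of_forall fun n => ?_⟩
    · have := (Complex.continuous_ofReal.tendsto 0).comp
        (tendsto_one_div_add_atTop_nhds_zero_nat (𝕜 := ℝ))
      simpa using this.const_add (1 : ℂ)
    · have : (1 / ((n : ℝ) + 1)) ≠ 0 := by positivity
      simpa using (Complex.ofReal_ne_zero.2 this)
  refine hlim.frequently (Filter.Eventually.frequently (Filter.Eventually.of_forall fun n => ?_))
  have hp : (0 : ℝ) < 1 + 1 / ((n : ℝ) + 1) := by positivity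
  have := Complex.integral_cpow_mul_exp_neg_mul_Ioi hs hp
  have e : (1 : ℂ) + ((1 / ((n : ℝ) + 1) : ℝ) : ℂ) = ((1 + 1 / ((n : ℝ) + 1) : ℝ) : ℂ) := by
    push_cast; rfl
  simp only [e]
  rw [this, one_div, Complex.inv_cpow, Complex.cpow_neg]
  rw [Complex.arg_ofReal_of_nonneg hp.le]
  exact Real.pi_pos.ne

lemma aux_re {z : ℂ} (hz : |z.im| < Real.pi / 2) : 0 < (Complex.exp z).re := by
  rw [Complex.exp_re]
  have := abs_lt.1 hz
  exact mul_pos (Real.exp_pos _) (Real.cos_pos_of_mem_Ioo ⟨by linarith, by linarith⟩)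

lemma aux_exp {s z : ℂ} (hs : 0 < s.re) (hz : |z.im| < Real.pi / 2) :
    ∫ t : ℝ in Set.Ioi 0, (t : ℂ) ^ (s - 1) * Complex.exp (-(Complex.exp z * t)) =
      Complex.exp (-(z * s)) * Complex.Gamma s := by
  rw [aux_formula hs (aux_re hz), Complex.cpow_def_of_ne_zero (Complex.exp_ne_zero _),
    Complex.log_exp]
  · simp
  · have := abs_lt.1 hz; linarith [Real.pi_pos]
  · have := abs_lt.1 hz; linarith [Real.pi_pos]

lemma aux_bound {b : ℝ} {z : ℂ} (hb : 0 < b) (hz : |z.im| < Real.pi / 2) :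
    ∃ C : ℝ, 0 ≤ C ∧ ∀ y : ℝ, ‖Complex.exp (-(z * (b + y * Complex.I))) *
      Complex.Gamma (b + y * Complex.I)‖ ≤ C := by
  refine ⟨∫ t : ℝ in Set.Ioi 0, t ^ (b - 1) * Real.exp (-((Complex.exp z).re * t)), ?_, fun y => ?_⟩
  · refine setIntegral_nonneg measurableSet_Ioi fun t ht => ?_
    have : (0 : ℝ) < t := ht
    positivity
  · rw [← aux_exp (by simpa using hb) hz]
    refine (norm_integral_le_integral_norm _).trans (le_of_eq ?_)
    refine setIntegral_congr_fun measurableSet_Ioi fun t ht => ?_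
    rw [aux_norm ht]
    simp

lemma aux_decay {a : ℝ} {z : ℂ} (ha : 0 < a) (hz : |z.im| < Real.pi / 2) :
    ∃ C : ℝ, ∀ y : ℝ, ‖Complex.exp (-(z * (a + y * Complex.I))) *
      Complex.Gamma (a + y * Complex.I)‖ ≤ C * (a ^ 2 + y ^ 2)⁻¹ := by
  obtain ⟨C, hC0, hC⟩ := aux_bound (b := a + 2) (by linarith) hz
  refine ⟨‖Complex.exp (2 * z)‖ * C, fun y => ?_⟩
  have hb := hC y
  set s : ℂ := a + y * Complex.I with hs
  have hre : s.re = a := by simp [hs]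
  have him : s.im = y := by simp [hs]
  have h0 : s ≠ 0 := fun h => by rw [h] at hre; simp at hre; linarith
  have h1 : s + 1 ≠ 0 := fun h => by
    have := congrArg Complex.re h; simp [hre] at this; linarith
  have e : ((a + 2 : ℝ) : ℂ) + y * Complex.I = s + 2 := by rw [hs]; push_cast; ring
  rw [e] at hb
  have hG : Complex.Gamma (s + 2) = (s + 1) * (s * Complex.Gamma s) := by
    rw [show s + 2 = (s + 1) + 1 by ring, Complex.Gamma_add_one _ h1, Complex.Gamma_add_one _ h0]
  have hsplit : Complex.exp (-(z * (s + 2))) = Complex.exp (-(z * s)) * (Complex.exp (2 * z))⁻¹ := by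
    rw [← Complex.exp_neg, ← Complex.exp_add]; congr 1; ring
  have hn0 : ‖s‖ ^ 2 = a ^ 2 + y ^ 2 := by
    rw [← Complex.normSq_eq_norm_sq, Complex.normSq_apply, hre, him]; ring
  have hn1 : ‖s‖ ≤ ‖s + 1‖ := by
    refine (sq_le_sq₀ (norm_nonneg _) (norm_nonneg _)).1 ?_
    rw [← Complex.normSq_eq_norm_sq, ← Complex.normSq_eq_norm_sq, Complex.normSq_apply,
      Complex.normSq_apply]
    simp [hre, him]; nlinarith
  rw [hG, hsplit, norm_mul, norm_mul, norm_inv, norm_mul, norm_mul] at hb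
  have hE : 0 < ‖Complex.exp (2 * z)‖ := norm_pos_iff.2 (Complex.exp_ne_zero _)
  have hpos : 0 < a ^ 2 + y ^ 2 := by positivity
  rw [← div_eq_mul_inv, le_div_iff₀ hpos, ← hn0, norm_mul]
  have hb2 : ‖Complex.exp (-(z * s))‖ * (‖s + 1‖ * (‖s‖ * ‖Complex.Gamma s‖)) ≤
      ‖Complex.exp (2 * z)‖ * C := by
    have := mul_le_mul_of_nonneg_left hb hE.le
    calc _ = ‖Complex.exp (2 * z)‖ * (‖Complex.exp (-(z * s))‖ * ‖Complex.exp (2 * z)‖⁻¹ *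
        (‖s + 1‖ * (‖s‖ * ‖Complex.Gamma s‖))) := by field_simp
      _ ≤ _ := this
  refine le_trans ?_ hb2
  calc ‖Complex.exp (-(z * s))‖ * ‖Complex.Gamma s‖ * ‖s‖ ^ 2 =
      ‖Complex.exp (-(z * s))‖ * (‖s‖ * (‖s‖ * ‖Complex.Gamma s‖)) := by ring
    _ ≤ _ := by gcongr

lemma aux_cont {a : ℝ} (z : ℂ) (ha : 0 < a) : Continuous fun y : ℝ =>
    Complex.exp (-(z * (a + y * Complex.I))) * Complex.Gamma (a + y * Complex.I) := by
  refine Continuous.mul (by fun_prop) ?_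
  refine continuous_iff_continuousAt.2 fun y => ?_
  refine ContinuousAt.comp (f := fun y : ℝ => (a : ℂ) + y * Complex.I) (g := Complex.Gamma) ?_
    (by fun_prop)
  refine (Complex.differentiableAt_Gamma _ fun m h => ?_).continuousAt
  have := congrArg Complex.re h
  simp at this
  have : (0 : ℝ) ≤ m := m.cast_nonneg
  linarith

lemma aux_integrable {a : ℝ} {z : ℂ} (ha : 0 < a) (hz : |z.im| < Real.pi / 2) :
    Integrable fun y : ℝ =>
    Complex.exp (-(z * (a + y * Complex.I))) * Complex.Gamma (a + y * Complex.I) := by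
  obtain ⟨C, hC⟩ := aux_decay ha hz
  have hi : Integrable fun y : ℝ => C * (a ^ 2 + y ^ 2)⁻¹ := by
    refine Integrable.const_mul ?_ C
    have := (integrable_inv_one_add_sq.comp_mul_right' (inv_ne_zero ha.ne')).const_mul ((a ^ 2)⁻¹)
    refine this.congr (Filter.Eventually.of_forall fun y => ?_)
    simp only
    field_simp
  exact hi.mono' (aux_cont z ha).aestronglyMeasurable (Filter.Eventually.of_forall hC)

open scoped FourierTransform in
lemma aux_fourier {a : ℝ} {z : ℂ} (ha : 0 < a) (hz : |z.im| < Real.pi / 2) (ξ : ℝ) :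
    𝓕 (fun u : ℝ => Real.exp (-a * u) • Complex.exp (-(Complex.exp z * (Real.exp (-u) : ℝ)))) ξ =
    Complex.exp (-(z * (a + (2 * Real.pi * ξ : ℝ) * Complex.I))) *
      Complex.Gamma (a + (2 * Real.pi * ξ : ℝ) * Complex.I) := by
  have h := mellin_eq_fourier (fun t : ℝ => Complex.exp (-(Complex.exp z * (t : ℝ))))
    (s := a + (2 * Real.pi * ξ : ℝ) * Complex.I)
  rw [mellin] at h
  simp only [smul_eq_mul] at h
  rw [aux_exp (by simpa using ha) hz] at h
  rw [h]
  have e1 : ((a : ℂ) + (2 * Real.pi * ξ : ℝ) * Complex.I).re = a := by simp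
  have e2 : ((a : ℂ) + (2 * Real.pi * ξ : ℝ) * Complex.I).im = 2 * Real.pi * ξ := by simp
  rw [e1, e2, mul_div_cancel_left₀ _ (by positivity)]

/-- change of variables `t = exp (-u)` -/
lemma aux_g_int {a : ℝ} {r : ℂ} (ha : 0 < a) (hr : 0 < r.re) :
    Integrable (fun u : ℝ => Real.exp (-a * u) • Complex.exp (-(r * (Real.exp (-u) : ℝ)))) := by
  have hf := aux_int (s := a) (by simpa using ha) hr
  have him : Real.exp ∘ Neg.neg '' Set.univ = Set.Ioi 0 := by
    rw [Set.image_comp, Set.image_univ_of_surjective neg_surjective, Set.image_univ, Real.range_exp]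
  have hd : ∀ x ∈ Set.univ, HasDerivWithinAt (Real.exp ∘ Neg.neg) (-Real.exp (-x)) Set.univ x :=
    fun x _ ↦ mul_neg_one (Real.exp (-x)) ▸
      ((Real.hasDerivAt_exp (-x)).comp x (hasDerivAt_neg x)).hasDerivWithinAt
  have hinj : Set.univ.InjOn (Real.exp ∘ Neg.neg) :=
    Real.exp_injective.injOn.comp neg_injective.injOn (Set.univ.mapsTo_univ _)
  rw [← him, integrableOn_image_iff_integrableOn_abs_deriv_smul
      MeasurableSet.univ hd hinj, integrableOn_univ] at hf
  refine hf.congr (Filter.Eventually.of_forall fun u => ?_)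
  simp only [Function.comp_apply, abs_neg, abs_of_pos (Real.exp_pos _), Complex.real_smul]
  rw [← mul_assoc]
  congr 1
  have : ((Real.exp (-u) : ℝ) : ℂ) ^ ((a : ℂ) - 1) = ((Real.exp (-u) ^ (a - 1) : ℝ) : ℂ) := by
    rw [Complex.ofReal_cpow (Real.exp_pos _).le]; push_cast; rfl
  rw [this, ← Complex.ofReal_mul, ← Real.exp_mul, ← Real.exp_add]
  congr 2; ring

open scoped FourierTransform in
lemma aux_main {a : ℝ} {z : ℂ} (ha : 0 < a) (hz : |z.im| < Real.pi / 2) :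
    Integrable (fun y : ℝ => Complex.exp (-(2 * y * z * Complex.I)) *
      (Complex.Gamma (a + y * Complex.I) * Complex.Gamma (a - y * Complex.I))) ∧
    ∫ y : ℝ, Complex.exp (-(2 * y * z * Complex.I)) *
      (Complex.Gamma (a + y * Complex.I) * Complex.Gamma (a - y * Complex.I)) =
    2 * Real.pi * ((2 * Complex.cosh z) ^ (-(2 * a : ℂ)) * Complex.Gamma (2 * a)) := by
  have hz' : |(-z).im| < Real.pi / 2 := by simpa using hz
  have hpi : (2 * Real.pi : ℝ) ≠ 0 := by positivity
  set H : ℝ → ℂ := fun y : ℝ => Complex.exp (-(2 * y * z * Complex.I)) *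
      (Complex.Gamma (a + y * Complex.I) * Complex.Gamma (a - y * Complex.I)) with hH
  set P : ℂ → ℝ → ℂ := fun z y =>
    Complex.exp (-(z * (a + y * Complex.I))) * Complex.Gamma (a + y * Complex.I) with hP
  have hHP : ∀ y, H y = P z y * P (-z) (-y) := fun y => by
    simp only [hH, hP]
    have : Complex.exp (-(2 * y * z * Complex.I)) = Complex.exp (-(z * (a + y * Complex.I))) *
        Complex.exp (-(-z * (a + (-y : ℝ) * Complex.I))) := by
      rw [← Complex.exp_add]; congr 1; push_cast; ring
    rw [this]
    push_cast
    rw [show (a : ℂ) + -y * Complex.I = a - y * Complex.I by ring]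
    ring
  have hPi : Integrable (P z) := aux_integrable ha hz
  refine ⟨?_, ?_⟩
  · obtain ⟨C, -, hC⟩ := aux_bound ha hz'
    have := hPi.mul_bdd (g := fun y => P (-z) (-y)) (c := C)
      ((aux_cont (-z) ha).comp continuous_neg).aestronglyMeasurable
      (Filter.Eventually.of_forall fun y => hC (-y))
    exact this.congr (Filter.Eventually.of_forall fun y => (hHP y).symm)
  · set G : ℂ → ℝ → ℂ := fun z u =>
      Real.exp (-a * u) • Complex.exp (-(Complex.exp z * (Real.exp (-u) : ℝ))) with hG
    have hF : ∀ w : ℂ, |w.im| < Real.pi / 2 → 𝓕 (G w) = fun ξ => P w (2 * Real.pi * ξ) :=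
      fun w hw => funext fun ξ => aux_fourier ha hw ξ
    have hGi : ∀ w : ℂ, |w.im| < Real.pi / 2 → Integrable (G w) :=
      fun w hw => aux_g_int ha (aux_re hw)
    have hFi : Integrable (𝓕 (G z)) := by
      rw [hF z hz]
      exact hPi.comp_mul_left' hpi
    have hGc : Continuous (G z) := by
      simp only [hG]; fun_prop
    have hinv := hGc.fourierInv_fourier_eq (hGi z hz) hFi
    have hself := VectorFourier.integral_fourierIntegral_smul_eq_flip (μ := volume) (ν := volume)
      (L := -innerₗ ℝ) (e := Real.fourierChar) (f := 𝓕 (G z)) (g := G (-z))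
      Real.continuous_fourierChar (by simpa using! continuous_inner.neg) hFi (hGi _ hz')
    have e1 : (∫ ξ, VectorFourier.fourierIntegral Real.fourierChar volume (-innerₗ ℝ)
        (𝓕 (G z)) ξ • G (-z) ξ) = ∫ u, G z u * G (-z) u := by
      change (∫ ξ, 𝓕⁻ (𝓕 (G z)) ξ • G (-z) ξ) = _
      rw [hinv]; rfl
    have hflip : (-innerₗ ℝ : ℝ →ₗ[ℝ] ℝ →ₗ[ℝ] ℝ).flip = -innerₗ ℝ := by
      ext; simp
    have e2 : (∫ x, 𝓕 (G z) x • VectorFourier.fourierIntegral Real.fourierChar volume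
        (-innerₗ ℝ : ℝ →ₗ[ℝ] ℝ →ₗ[ℝ] ℝ).flip (G (-z)) x) = ∫ x, H (2 * Real.pi * x) := by
      rw [hflip]
      change (∫ x, 𝓕 (G z) x • 𝓕⁻ (G (-z)) x) = _
      refine integral_congr_ae (Filter.Eventually.of_forall fun x => ?_)
      simp only
      rw [Real.fourierInv_eq_fourier_neg, hF z hz, hF _ hz', hHP, smul_eq_mul]
      simp only
      rw [mul_neg]
    rw [e1, e2, Measure.integral_comp_mul_left] at hself
    have hval : ∫ u, G z u * G (-z) u = (2 * Complex.cosh z) ^ (-(2 * a : ℂ)) *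
        Complex.Gamma (2 * a) := by
      have hsum : Complex.exp z + Complex.exp (-z) = 2 * Complex.cosh z := by
        rw [Complex.cosh]; ring
      have hre : 0 < (2 * Complex.cosh z).re := by
        rw [← hsum, Complex.add_re]
        exact add_pos (aux_re hz) (aux_re hz')
      have hm := mellin_eq_fourier (fun t : ℝ => Complex.exp (-(2 * Complex.cosh z * (t : ℝ))))
        (s := 2 * a)
      rw [mellin] at hm
      simp only [smul_eq_mul] at hm
      rw [aux_formula (by simpa using ha) hre] at hm
      rw [hm, Real.fourier_eq']
      refine integral_congr_ae (Filter.Eventually.of_forall fun u => ?_)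
      simp only [hG, Complex.real_smul]
      rw [← hsum]
      simp
      generalize Complex.exp z = p
      generalize Complex.exp (-z) = q
      generalize Complex.exp (-(u : ℂ)) = v
      simp only [← Complex.exp_add]
      congr 1
      ring
    rw [hval] at hself
    rw [hself, abs_of_pos (by positivity), Complex.real_smul]
    push_cast
    rw [← mul_assoc, mul_inv_cancel₀ (by exact_mod_cast hpi), one_mul]

lemma aux_phi (A : ℝ) (hA : -1 < A) : ∃ z : ℂ, |z.im| < Real.pi / 2 ∧
    Complex.cosh z = (Real.sqrt (1 + A) : ℝ) ∧ ∀ s : ℝ, (phiF A s : ℂ) =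
      (Complex.exp (-(2 * (-s : ℝ) * z * Complex.I)) +
        Complex.exp (-(2 * s * z * Complex.I))) / 2 := by
  by_cases h : 0 ≤ A
  · refine ⟨(Real.log (Real.sqrt (A + 1) + Real.sqrt A) : ℝ), ?_, ?_, fun s => ?_⟩
    · simp [Real.pi_pos]
    · rw [← Complex.ofReal_cosh]
      have hx : 0 < Real.sqrt (A + 1) + Real.sqrt A := by positivity
      have hinv : (Real.sqrt (A + 1) + Real.sqrt A)⁻¹ = Real.sqrt (A + 1) - Real.sqrt A := by
        rw [inv_eq_one_div, div_eq_iff hx.ne']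
        have h1 := Real.mul_self_sqrt (show 0 ≤ A + 1 by linarith)
        have h2 := Real.mul_self_sqrt h
        nlinarith
      rw [Real.cosh_log hx, hinv, add_comm 1 A]
      congr 1; ring
    · rw [phiF, if_pos h, Complex.ofReal_cos, Complex.cos]
      push_cast
      congr 2 <;> congr 1 <;> ring
  · have hA0 : 0 ≤ -A := by linarith
    have hlt : Real.arcsin (Real.sqrt (-A)) < Real.pi / 2 := by
      refine Real.arcsin_lt_pi_div_two.2 ?_
      rw [Real.sqrt_lt' one_pos]; linarith
    refine ⟨(Real.arcsin (Real.sqrt (-A)) : ℝ) * Complex.I, ?_, ?_, fun s => ?_⟩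
    · rw [Complex.im_ofReal_mul, Complex.I_im, mul_one, abs_of_nonneg]
      · exact hlt
      · exact Real.arcsin_nonneg.2 (Real.sqrt_nonneg _)
    · rw [Complex.cosh_mul_I, ← Complex.ofReal_cos, Real.cos_arcsin, Real.sq_sqrt hA0, sub_neg_eq_add]
    · rw [phiF, if_neg h, Complex.ofReal_cosh, Complex.cosh, add_comm (Complex.exp _)]
      push_cast
      have hI := Complex.I_mul_I
      congr 3
      · linear_combination (-2 * s * (Real.arcsin (Real.sqrt (-A)) : ℂ)) * hI
      · linear_combination (2 * s * (Real.arcsin (Real.sqrt (-A)) : ℂ)) * hI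

lemma aux_dup {s : ℝ} (hs : 0 < s) :
    Complex.Gamma (Complex.I * s) * Complex.Gamma (-(Complex.I * s)) *
          Complex.Gamma (1 / 2 + Complex.I * s) * Complex.Gamma (1 / 2 - Complex.I * s) =
    4 * Real.pi * (Complex.Gamma (2 * Complex.I * s) * Complex.Gamma (-(2 * Complex.I * s))) := by
  have h1 := Complex.Gamma_mul_Gamma_add_half (Complex.I * s)
  have h2 := Complex.Gamma_mul_Gamma_add_half (-(Complex.I * s))
  rw [show Complex.I * s + 1 / 2 = 1 / 2 + Complex.I * s by ring, ← mul_assoc] at h1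
  rw [show -(Complex.I * s) + 1 / 2 = 1 / 2 - Complex.I * s by ring,
    show 2 * -(Complex.I * s) = -(2 * Complex.I * s) by ring] at h2
  have h3 : (2 : ℂ) ^ (1 - 2 * Complex.I * s) * (2 : ℂ) ^ (1 - -(2 * Complex.I * s)) = 4 := by
    rw [← Complex.cpow_add _ _ two_ne_zero, show 1 - 2 * Complex.I * s + (1 - -(2 * Complex.I * s))
      = (2 : ℕ) by push_cast; ring, Complex.cpow_natCast]
    norm_num
  have h4 : ((Real.sqrt Real.pi : ℝ) : ℂ) * (Real.sqrt Real.pi : ℝ) = Real.pi := by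
    rw [← Complex.ofReal_mul, Real.mul_self_sqrt Real.pi_pos.le]
  calc _ = (Complex.Gamma (Complex.I * s) * Complex.Gamma (1 / 2 + Complex.I * s)) *
      (Complex.Gamma (-(Complex.I * s)) * Complex.Gamma (1 / 2 - Complex.I * s)) := by ring
    _ = _ := by
      rw [h1, h2, ← h3, ← h4]; ring

theorem stmt_6 (A T : ℝ) (hA : -1 < A) (hT : 0 ≤ T) :
    (1 / (2 * Real.pi) : ℂ) *
      ∫ s in Set.Ioi (0 : ℝ),
        (Complex.Gamma (Complex.I * s) * Complex.Gamma (-(Complex.I * s)) *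
          Complex.Gamma (1 / 2 + Complex.I * s) * Complex.Gamma (1 / 2 - Complex.I * s) *
          Complex.Gamma (1 / 2 + T + Complex.I * s) * Complex.Gamma (1 / 2 + T - Complex.I * s) /
          (Complex.Gamma (2 * Complex.I * s) * Complex.Gamma (-(2 * Complex.I * s)))) *
        (phiF A s : ℝ) =
    Complex.Gamma (1 / 2) * Complex.Gamma (1 + T) * Complex.Gamma (1 / 2 + T) *
      (((1 + A) ^ (-(1 / 2 : ℝ) - T) : ℝ) : ℂ) := by
  obtain ⟨z, hz, hcosh, hphi⟩ := aux_phi A hA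
  have ha : 0 < 1 / 2 + T := by linarith
  obtain ⟨hint, hval⟩ := aux_main ha hz
  set H : ℝ → ℂ := fun y : ℝ => Complex.exp (-(2 * y * z * Complex.I)) *
      (Complex.Gamma ((1 / 2 + T : ℝ) + y * Complex.I) *
        Complex.Gamma ((1 / 2 + T : ℝ) - y * Complex.I)) with hH
  have hhalf : ∫ y, H y = ∫ y in Set.Ioi (0 : ℝ), (H (-y) + H y) := by
    have hneg : Integrable fun y => H (-y) := hint.comp_neg
    rw [integral_add hneg.integrableOn hint.integrableOn, integral_comp_neg_Ioi, neg_zero,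
      intervalIntegral.integral_Iic_add_Ioi hint.integrableOn hint.integrableOn]
  have hI : ∀ s ∈ Set.Ioi (0 : ℝ), (Complex.Gamma (Complex.I * s) * Complex.Gamma (-(Complex.I * s)) *
          Complex.Gamma (1 / 2 + Complex.I * s) * Complex.Gamma (1 / 2 - Complex.I * s) *
          Complex.Gamma (1 / 2 + T + Complex.I * s) * Complex.Gamma (1 / 2 + T - Complex.I * s) /
          (Complex.Gamma (2 * Complex.I * s) * Complex.Gamma (-(2 * Complex.I * s)))) *
        (phiF A s : ℝ) = 2 * Real.pi * (H (-s) + H s) := by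
    intro s hs
    have hs' : (0 : ℝ) < s := hs
    have hG : ∀ w : ℂ, w.im ≠ 0 → Complex.Gamma w ≠ 0 := fun w hw =>
      Complex.Gamma_ne_zero fun m h => hw (by rw [h]; simp)
    have n1 : Complex.Gamma (2 * Complex.I * s) ≠ 0 := hG _ (by simp [hs'.ne'])
    have n2 : Complex.Gamma (-(2 * Complex.I * s)) ≠ 0 := hG _ (by simp [hs'.ne'])
    rw [aux_dup hs', hphi]
    simp only [hH]
    push_cast
    rw [show (1 / 2 + (T : ℂ) + -s * Complex.I) = 1 / 2 + T - s * Complex.I by ring,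
      show (1 / 2 + (T : ℂ) - -s * Complex.I) = 1 / 2 + T + s * Complex.I by ring,
      mul_comm Complex.I (s : ℂ)]
    field_simp
    ring
  rw [setIntegral_congr_fun measurableSet_Ioi hI, integral_const_mul, ← hhalf, hval, hcosh]
  have hpi : (Real.pi : ℂ) ≠ 0 := by exact_mod_cast Real.pi_ne_zero
  have hA1 : 0 < 1 + A := by linarith
  have hdup := Complex.Gamma_mul_Gamma_add_half ((1 / 2 + T : ℝ) : ℂ)
  have hg : Complex.Gamma (1 / 2) = (Real.sqrt Real.pi : ℝ) := by
    rw [← Real.Gamma_one_half_eq, ← Complex.Gamma_ofReal]; push_cast; rfl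
  have h4 : ((Real.sqrt Real.pi : ℝ) : ℂ) * (Real.sqrt Real.pi : ℝ) = Real.pi := by
    rw [← Complex.ofReal_mul, Real.mul_self_sqrt Real.pi_pos.le]
  have hpow : ((2 : ℂ) * (Real.sqrt (1 + A) : ℝ)) ^ (-(2 * ((1 / 2 + T : ℝ) : ℂ))) =
      (((2 : ℝ) ^ (-(2 * (1 / 2 + T))) : ℝ) : ℂ) * (((1 + A) ^ (-(1 / 2 : ℝ) - T) : ℝ) : ℂ) := by
    rw [← Complex.ofReal_mul]
    have e : (1 + A) ^ (-(1 / 2 : ℝ) - T) = Real.sqrt (1 + A) ^ (-(2 * (1 / 2 + T))) := by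
      rw [Real.sqrt_eq_rpow, ← Real.rpow_mul hA1.le]; congr 1; ring
    rw [e, ← Real.mul_rpow (by norm_num) (Real.sqrt_nonneg _), Complex.ofReal_cpow (by positivity)]
    push_cast; rfl
  have h2 : (2 : ℂ) ^ (1 - 2 * ((1 / 2 + T : ℝ) : ℂ)) =
      2 * (((2 : ℝ) ^ (-(2 * (1 / 2 + T))) : ℝ) : ℂ) := by
    rw [sub_eq_add_neg, Complex.cpow_add _ _ two_ne_zero, Complex.cpow_one,
      Complex.ofReal_cpow (by norm_num)]
    push_cast; rfl
  rw [hpow, hg]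
  rw [h2, show ((1 / 2 + T : ℝ) : ℂ) + 1 / 2 = 1 + T by push_cast; ring] at hdup
  rw [show (1 / 2 + (T : ℂ)) = ((1 / 2 + T : ℝ) : ℂ) by push_cast; rfl]
  rw [mul_assoc ((Real.sqrt Real.pi : ℝ) : ℂ), mul_comm (Complex.Gamma (1 + T)), hdup]
  field_simp
  rw [← h4]
  ring
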